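/- arXiv:2210.16783 — 2 statements merged into one kernel-verified Lean document; each statement's English description precedes it below -/
import Mathlib

section
/- For every m ≥ 4 and k > 8, the spaces ʳΩ_k^{(2m-2)k-1,3}(CP^m), ʳΩ_k^{(2m-2)k,2}(CP^m), ʳΩ_k^{(2m-2)k+1,1}(CP^m), ʳΩ_k^{(2m-2)k+2,0}(CP^m) have dimensions 1, 3, 3, 1 respectively, and the sequence 0 → ʳΩ_k^{(2m-2)k-1,3} →∂ ʳΩ_k^{(2m-2)k,2} →∂ ʳΩ_k^{(2m-2)k+1,1} →∂ ʳΩ_k^{(2m-2)k+2,0} → 0 is exact (the first map is injective, the last is surjective, and kernels equal images at the middle terms). -/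
/-!
# The (reduced) Chevalley–Eilenberg complex for `ℂP^m`

We model the free graded-commutative algebra on generators
`v_0, v_2, …, v_{2m}` (even, polynomial; `v_{2i}` has degree `2i`, weight `0`, length `1`) and
`w_{2m-1}, w_{2m+1}, …, w_{4m-1}` (odd, exterior; `w_{2m-1+2j}` has degree `2m-1+2j`,
weight `1`, length `2`) by its monomial basis: a monomial is a pair `(e, S)` where
`e : Fin (m+1) → ℕ` records the exponents of the `v`'s (`e i` is the exponent of `v_{2i}`) and
`S : Finset (Fin (m+1))` records the set of `w`'s occurring (`j ∈ S` means `w_{2m-1+2j}` occurs).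
An element of the algebra is a finitely supported `ℚ`-linear combination of monomials.
The differential is the degree `+1` derivation with `∂ v_{2i} = 0` and
`∂ w_{2i-1} = ∑_{a+b=i, 0 ≤ a,b ≤ m} v_{2a} v_{2b}` (for `m ≤ i ≤ 2m`), with the usual
Koszul signs.
-/

noncomputable section

/-- Monomials: exponents of the even generators `v_{2i}` and the set of odd generators
`w_{2m-1+2j}` occurring. -/
abbrev CEMon (m : ℕ) : Type := (Fin (m + 1) → ℕ) × Finset (Fin (m + 1))

/-- The underlying `ℚ`-vector space of the Chevalley–Eilenberg algebra for `ℂP^m`: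
finitely supported linear combinations of monomials. -/
abbrev CEAlg (m : ℕ) : Type := CEMon m →₀ ℚ

/-- Cohomological degree of a monomial: `v_{2i}` has degree `2i` and `w_{2m-1+2j}` has
degree `2m - 1 + 2j`. -/
def CEdeg (m : ℕ) (b : CEMon m) : ℕ :=
  (∑ i : Fin (m + 1), 2 * i.val * b.1 i) + ∑ j ∈ b.2, (2 * m + 2 * j.val - 1)

/-- Length of a monomial: each `v` has length `1`, each `w` has length `2`. -/
def CElen (m : ℕ) (b : CEMon m) : ℕ := (∑ i : Fin (m + 1), b.1 i) + 2 * b.2.card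

/-- Weight of a monomial: each `v` has weight `0`, each `w` has weight `1`. -/
def CEwt (m : ℕ) (b : CEMon m) : ℕ := b.2.card

/-- The differential on a monomial: apply `∂ w_{2(m+j)-1} = ∑_{a+b=m+j, 0 ≤ a,b ≤ m} v_{2a} v_{2b}`
to each odd factor in turn, with the Koszul sign `(-1)^{#{l ∈ S | l < j}}` (writing the odd
factors in increasing order). -/
def CEdMon (m : ℕ) (b : CEMon m) : CEAlg m :=
  ∑ j ∈ b.2, ∑ a : Fin (m + 1),
    if h : j.val ≤ a.val then
      Finsupp.single
        (b.1 + Pi.single a 1 + Pi.single (⟨m + j.val - a.val, by omega⟩ : Fin (m + 1)) 1,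
          b.2.erase j)
        ((-1 : ℚ) ^ (b.2.filter (fun l => l < j)).card)
    else 0

/-- The Chevalley–Eilenberg differential `∂`, as a linear map. -/
def CEd (m : ℕ) : CEAlg m →ₗ[ℚ] CEAlg m :=
  Finsupp.lift (CEAlg m) ℚ (CEMon m) (CEdMon m)

/-- `Ω_k^{i,ω}(ℂP^m)`: the span of the monomials of length `k`, cohomological degree `i` and
weight `ω`. -/
def CEOmega (m k i ω : ℕ) : Submodule ℚ (CEAlg m) :=
  Finsupp.supported ℚ ℚ {b : CEMon m | CElen m b = k ∧ CEdeg m b = i ∧ CEwt m b = ω}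

/-- A monomial is *bad* if it is divisible by `v_{2m}²` or by `w_{4m-1}`. -/
def CEBad (m : ℕ) (b : CEMon m) : Prop :=
  2 ≤ b.1 (Fin.last m) ∨ Fin.last m ∈ b.2

open Classical in
/-- The projection of the Chevalley–Eilenberg algebra onto the span of the *good* monomials
(those not divisible by `v_{2m}²` nor by `w_{4m-1}`), annihilating the bad monomials.  The span
of the good monomials is canonically identified with the quotient of the algebra by the span of
the bad monomials. -/
def CEproj (m : ℕ) : CEAlg m →ₗ[ℚ] CEAlg m :=
  Finsupp.lift (CEAlg m) ℚ (CEMon m)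
    (fun b => if CEBad m b then 0 else Finsupp.single b (1 : ℚ))

/-- The induced differential on the reduced complex `ʳΩ` (realized as the span of the good
monomials, canonically identified with the quotient by the span of the bad monomials). -/
def CErd (m : ℕ) : CEAlg m →ₗ[ℚ] CEAlg m := (CEproj m).comp (CEd m)

/-- `ʳΩ_k^{i,ω}(ℂP^m)`: the reduced complex (the quotient of `Ω_k^{i,ω}(ℂP^m)` by the span of
the bad monomials, realized as the span of the good monomials of length `k`, degree `i` and
weight `ω`). -/
def CErOmega (m k i ω : ℕ) : Submodule ℚ (CEAlg m) :=
  Finsupp.supported ℚ ℚ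
    {b : CEMon m | ¬ CEBad m b ∧ CElen m b = k ∧ CEdeg m b = i ∧ CEwt m b = ω}

/-- The degree-`i` part of the reduced complex `ʳΩ_k^{*,*}(ℂP^m)` (all weights together). -/
def CErOmegaDeg (m k i : ℕ) : Submodule ℚ (CEAlg m) :=
  Finsupp.supported ℚ ℚ {b : CEMon m | ¬ CEBad m b ∧ CElen m b = k ∧ CEdeg m b = i}

/-- Cocycles of degree `i` in the reduced complex `ʳΩ_k^{*,*}(ℂP^m)`. -/
def CErCocycles (m k i : ℕ) : Submodule ℚ (CEAlg m) :=
  CErOmegaDeg m k i ⊓ LinearMap.ker (CErd m)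

/-- The degree-`i` cohomology of the reduced complex `ʳΩ_k^{*,*}(ℂP^m)`:
cocycles of degree `i` modulo the image of the degree-`(i-1)` part under the differential. -/
abbrev CErCohomology (m k i : ℕ) : Type :=
  CErCocycles m k i ⧸
    Submodule.comap (CErCocycles m k i).subtype
      (Submodule.map (CErd m) (CErOmegaDeg m k (i - 1)))

end

section TopDegree

open Finset

/-- A sum over `Fin (n + 5)` with its last four terms split off. -/
lemma Fin.sum_univ_split_last_four {M : Type*} [AddCommMonoid M] (n : ℕ) (f : Fin (n + 5) → M) :
    ∑ i, f i = ∑ i : Fin (n + 1), f ⟨i, by omega⟩ + f ⟨n + 1, by omega⟩ + f ⟨n + 2, by omega⟩ +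
      f ⟨n + 3, by omega⟩ + f ⟨n + 4, by omega⟩ := by
  rw [Fin.sum_univ_castSucc, Fin.sum_univ_castSucc, Fin.sum_univ_castSucc, Fin.sum_univ_castSucc]
  rfl

/-- Exponents of `v_{2m}^a v_{2m-2}^b v_{2m-4}^c`, where `m = n + 4`. -/
def topExp (n a b c : ℕ) : Fin (n + 5) → ℕ := fun i =>
  if i.val = n + 4 then a else if i.val = n + 3 then b else if i.val = n + 2 then c else 0

/-- The set of odd generators among `w_{4m-3}, w_{4m-5}, w_{4m-7}` selected by three flags,
where `m = n + 4`. -/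
def topSet (n : ℕ) (x y z : Bool) : Finset (Fin (n + 5)) :=
  univ.filter fun j =>
    (j.val = n + 3 ∧ x = true) ∨ (j.val = n + 2 ∧ y = true) ∨ (j.val = n + 1 ∧ z = true)

lemma mem_topSet {n : ℕ} {x y z : Bool} {j : Fin (n + 5)} : j ∈ topSet n x y z ↔
    (j.val = n + 3 ∧ x = true) ∨ (j.val = n + 2 ∧ y = true) ∨ (j.val = n + 1 ∧ z = true) := by
  simp [topSet]

lemma sum_topSet {M : Type*} [AddCommMonoid M] (n : ℕ) (x y z : Bool) (f : Fin (n + 5) → M) :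
    ∑ j ∈ topSet n x y z, f j = (if z then f ⟨n + 1, by omega⟩ else 0) +
      (if y then f ⟨n + 2, by omega⟩ else 0) + (if x then f ⟨n + 3, by omega⟩ else 0) := by
  rw [topSet, sum_filter, Fin.sum_univ_split_last_four, Finset.sum_eq_zero]
  · simp
  · intro i _
    rw [if_neg]
    simp only
    omega

lemma card_topSet (n : ℕ) (x y z : Bool) :
    (topSet n x y z).card = x.toNat + y.toNat + z.toNat := by
  rw [card_eq_sum_ones, sum_topSet]
  cases x <;> cases y <;> cases z <;> rfl

/-- The amount by which the degree exceeds `(2m - 2)` times the length. -/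
lemma CEdeg_eq_mul_CElen_add (n : ℕ) (b : CEMon (n + 4)) :
    (CEdeg (n + 4) b : ℤ) = (2 * (n + 4) - 2) * CElen (n + 4) b +
      ∑ i, (2 * (i.val : ℤ) - (2 * n + 6)) * b.1 i +
      ∑ j ∈ b.2, (2 * (j.val : ℤ) - 2 * n - 5) := by
  have h : ∀ j : Fin (n + 5), ((2 * (n + 4) + 2 * j.val - 1 : ℕ) : ℤ)
      = 2 * (n + 4) + 2 * j.val - 1 := fun j => by omega
  simp only [CEdeg, CElen]
  push_cast [h]
  simp only [sub_mul, sum_sub_distrib, sum_add_distrib, ← mul_sum, sum_const, nsmul_eq_mul]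
  ring

lemma CEdeg_topMon (n a b c : ℕ) (x y z : Bool) :
    (CEdeg (n + 4) (topExp n a b c, topSet n x y z) : ℤ) =
      (2 * (n + 4) - 2) * CElen (n + 4) (topExp n a b c, topSet n x y z) +
      2 * a - 2 * c + x.toNat - y.toNat - 3 * z.toNat := by
  rw [CEdeg_eq_mul_CElen_add, sum_topSet, Fin.sum_univ_split_last_four, Finset.sum_eq_zero]
  · simp only [topExp]
    cases x <;> cases y <;> cases z <;> simp <;> ring
  · intro i _
    have := i.isLt
    simp only [topExp]
    rw [if_neg (by omega), if_neg (by omega), if_neg (by omega)]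
    simp

lemma CElen_topMon (n a b c : ℕ) (x y z : Bool) :
    CElen (n + 4) (topExp n a b c, topSet n x y z) =
      a + b + c + 2 * (x.toNat + y.toNat + z.toNat) := by
  rw [CElen, card_topSet, Fin.sum_univ_split_last_four, Finset.sum_eq_zero]
  · simp [topExp]
    ring
  · intro i _
    have := i.isLt
    simp only [topExp]
    rw [if_neg (by omega), if_neg (by omega), if_neg (by omega)]

lemma CEBad_topMon {n a b c : ℕ} {x y z : Bool} :
    CEBad (n + 4) (topExp n a b c, topSet n x y z) ↔ 2 ≤ a := by
  simp [CEBad, topExp, mem_topSet]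

/-- A good monomial of length `k` and weight `ω` has degree `(2m - 2) k + 2 - ω` only if it is a
product of generators of top degree. -/
lemma exists_eq_topMon {n k ω : ℕ} {b : CEMon (n + 4)} (hb : ¬ CEBad (n + 4) b)
    (hlen : CElen (n + 4) b = k) (hwt : CEwt (n + 4) b = ω)
    (hdeg : (CEdeg (n + 4) b : ℤ) = (2 * (n + 4) - 2) * k + 2 - ω) :
    ∃ (a₀ a₁ a₂ : ℕ) (x y z : Bool), b = (topExp n a₀ a₁ a₂, topSet n x y z) ∧ a₀ ≤ 1 ∧
      a₀ + a₁ + a₂ + 2 * ω = k ∧ x.toNat + y.toNat + z.toNat = ω ∧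
      2 * (a₀ : ℤ) - 2 * a₂ + x.toNat - y.toNat - 3 * z.toNat = 2 - ω := by
  obtain ⟨e, S⟩ := b
  rw [CEdeg_eq_mul_CElen_add, hlen] at hdeg
  simp only [CElen, CEwt] at hlen hwt
  rw [hwt] at hlen
  simp only [CEBad, not_or, not_le] at hb
  obtain ⟨he, hS⟩ := hb
  have hcard : ∑ j, (if j ∈ S then 1 else 0) = ω := by
    rw [← hwt, card_eq_sum_ones, ← sum_filter]; simp
  have hind : ∑ j ∈ S, (2 * (j.val : ℤ) - 2 * n - 5) =
      ∑ j, (if j ∈ S then (2 * (j.val : ℤ) - 2 * n - 5) else 0) := by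
    rw [← sum_filter]; simp
  rw [hind, Fin.sum_univ_split_last_four, Fin.sum_univ_split_last_four] at hdeg
  rw [Fin.sum_univ_split_last_four] at hlen hcard
  have hS' : (⟨n + 4, by omega⟩ : Fin (n + 5)) ∉ S := hS
  have he' : e ⟨n + 4, by omega⟩ < 2 := he
  have hR : ∑ i : Fin (n + 1), (2 * (i.val : ℤ) - (2 * n + 6)) * e ⟨i, by omega⟩ ≤
      -6 * (∑ i : Fin (n + 1), e ⟨i, by omega⟩ : ℕ) := by
    push_cast
    rw [mul_sum]
    refine sum_le_sum fun i _ => mul_le_mul_of_nonneg_right ?_ (by positivity)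
    omega
  have hD : ∑ j : Fin (n + 1), (if (⟨j, by omega⟩ : Fin (n + 5)) ∈ S then
      (2 * (j.val : ℤ) - 2 * n - 5) else 0) ≤
      -5 * (∑ j : Fin (n + 1), (if (⟨j, by omega⟩ : Fin (n + 5)) ∈ S then 1 else 0) : ℕ) := by
    push_cast
    rw [mul_sum]
    refine sum_le_sum fun j _ => ?_
    split_ifs <;> omega
  simp only [if_neg hS'] at hdeg hcard
  generalize hRv : (∑ i : Fin (n + 1), e ⟨i, by omega⟩) = R at hR hlen
  generalize hDv : (∑ j : Fin (n + 1), (if (⟨j, by omega⟩ : Fin (n + 5)) ∈ S then 1 else 0)) = d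
    at hD hcard
  generalize hREv : (∑ i : Fin (n + 1), (2 * (i.val : ℤ) - (2 * n + 6)) * e ⟨i, by omega⟩) = RE
    at hR hdeg
  generalize hSEv : (∑ j : Fin (n + 1), (if (⟨j, by omega⟩ : Fin (n + 5)) ∈ S then
      (2 * (j.val : ℤ) - 2 * n - 5) else 0)) = SE at hD hdeg
  generalize (2 * ((n : ℤ) + 4) - 2) * k = K at hdeg
  have h1 (x : ℤ) : (2 * ((n + 1 : ℕ) : ℤ) - (2 * n + 6)) * x = -4 * x := by push_cast; ring
  have h2 (x : ℤ) : (2 * ((n + 2 : ℕ) : ℤ) - (2 * n + 6)) * x = -2 * x := by push_cast; ring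
  have h3 (x : ℤ) : (2 * ((n + 3 : ℕ) : ℤ) - (2 * n + 6)) * x = 0 := by push_cast; ring
  have h4 (x : ℤ) : (2 * ((n + 4 : ℕ) : ℤ) - (2 * n + 6)) * x = 2 * x := by push_cast; ring
  simp only [h1, h2, h3, h4] at hdeg
  have key : R = 0 ∧ d = 0 ∧ e ⟨n + 1, by omega⟩ = 0 := by
    split_ifs at hdeg hcard <;> omega
  obtain ⟨rfl, rfl, hs⟩ := key
  have htoNat (p : Prop) [Decidable p] : (decide p).toNat = if p then 1 else 0 := by
    split_ifs with h <;> simp [h]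
  have he0 : ∀ i : Fin (n + 1), e ⟨i, by omega⟩ = 0 := fun i =>
    sum_eq_zero_iff.1 hRv i (mem_univ i)
  have hS0 : ∀ i : Fin (n + 1), (⟨i, by omega⟩ : Fin (n + 5)) ∉ S := fun i hi => by
    simpa [hi] using sum_eq_zero_iff.1 hDv i (mem_univ i)
  have hRE0 : RE = 0 := by rw [← hREv]; exact sum_eq_zero fun i _ => by simp [he0]
  have hSE0 : SE = 0 := by rw [← hSEv]; exact sum_eq_zero fun i _ => by simp [hS0]
  refine ⟨e ⟨n + 4, by omega⟩, e ⟨n + 3, by omega⟩, e ⟨n + 2, by omega⟩,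
    decide (⟨n + 3, by omega⟩ ∈ S), decide (⟨n + 2, by omega⟩ ∈ S),
    decide (⟨n + 1, by omega⟩ ∈ S), ?_, by omega, by omega, ?_, ?_⟩
  · have hcases : ∀ i : Fin (n + 5), (∃ j : Fin (n + 1), i = ⟨j, by omega⟩) ∨
        i = ⟨n + 1, by omega⟩ ∨ i = ⟨n + 2, by omega⟩ ∨ i = ⟨n + 3, by omega⟩ ∨
        i = ⟨n + 4, by omega⟩ := fun i => by
      by_cases hi : i.val < n + 1
      · exact Or.inl ⟨⟨i, hi⟩, rfl⟩
      · simp only [Fin.ext_iff]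
        omega
    refine Prod.ext (funext fun i => ?_) (Finset.ext fun i => ?_)
    · rcases hcases i with ⟨j, rfl⟩ | rfl | rfl | rfl | rfl
      · have := j.isLt
        simp only [topExp]
        rw [he0, if_neg (by omega), if_neg (by omega), if_neg (by omega)]
      all_goals simp [topExp, hs]
    · rcases hcases i with ⟨j, rfl⟩ | rfl | rfl | rfl | rfl
      · have := j.isLt
        simp only [hS0, mem_topSet, false_iff]
        omega
      all_goals simp [mem_topSet, hS']
  · simp only [htoNat]
    omega
  · simp only [htoNat]
    split_ifs at hdeg hcard ⊢ <;> omega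

/-- The good monomials of length `k`, weight `ω` and degree `(2m - 2) k + 2 - ω`. -/
lemma setOf_good_eq {n k ω d : ℕ} (hd : (d : ℤ) = (2 * (n + 4) - 2) * k + 2 - ω) :
    {b : CEMon (n + 4) | ¬ CEBad (n + 4) b ∧ CElen (n + 4) b = k ∧ CEdeg (n + 4) b = d ∧
      CEwt (n + 4) b = ω} =
    {b | ∃ (a₀ a₁ a₂ : ℕ) (x y z : Bool), b = (topExp n a₀ a₁ a₂, topSet n x y z) ∧ a₀ ≤ 1 ∧
      a₀ + a₁ + a₂ + 2 * ω = k ∧ x.toNat + y.toNat + z.toNat = ω ∧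
      2 * (a₀ : ℤ) - 2 * a₂ + x.toNat - y.toNat - 3 * z.toNat = 2 - ω} := by
  ext b
  constructor
  · rintro ⟨hb, hlen, hdeg, hwt⟩
    exact exists_eq_topMon hb hlen hwt (by rw [hdeg, hd])
  · rintro ⟨a₀, a₁, a₂, x, y, z, rfl, ha, hk, hω, he⟩
    have hlen : CElen (n + 4) (topExp n a₀ a₁ a₂, topSet n x y z) = k := by
      rw [CElen_topMon, hω, hk]
    refine ⟨by rw [CEBad_topMon]; omega, hlen, ?_, by rw [CEwt, card_topSet, hω]⟩
    have := CEdeg_topMon n a₀ a₁ a₂ x y z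
    rw [hlen] at this
    zify
    linarith

lemma setOf_good_three (n l : ℕ) {d : ℕ}
    (hd : (d : ℤ) = (2 * (n + 4) - 2) * (l + 7 : ℕ) + 2 - (3 : ℕ)) :
    {b : CEMon (n + 4) | ¬ CEBad (n + 4) b ∧ CElen (n + 4) b = l + 7 ∧ CEdeg (n + 4) b = d ∧
      CEwt (n + 4) b = 3} = {(topExp n 1 l 0, topSet n true true true)} := by
  rw [setOf_good_eq hd]
  ext b
  constructor
  · rintro ⟨a₀, a₁, a₂, x, y, z, rfl, ha, hk, hω, he⟩
    cases x <;> cases y <;> cases z <;> simp at hω he ⊢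
    obtain ⟨rfl, rfl, rfl⟩ : a₀ = 1 ∧ a₁ = l ∧ a₂ = 0 := by omega
    rfl
  · rintro rfl
    exact ⟨_, _, _, _, _, _, rfl, by simp; try omega⟩

lemma setOf_good_two (n l : ℕ) {d : ℕ}
    (hd : (d : ℤ) = (2 * (n + 4) - 2) * (l + 7 : ℕ) + 2 - (2 : ℕ)) :
    {b : CEMon (n + 4) | ¬ CEBad (n + 4) b ∧ CElen (n + 4) b = l + 7 ∧ CEdeg (n + 4) b = d ∧
      CEwt (n + 4) b = 2} = {(topExp n 0 (l + 3) 0, topSet n true true false),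
        (topExp n 1 (l + 1) 1, topSet n true true false),
        (topExp n 1 (l + 2) 0, topSet n true false true)} := by
  rw [setOf_good_eq hd]
  ext b
  constructor
  · rintro ⟨a₀, a₁, a₂, x, y, z, rfl, ha, hk, hω, he⟩
    interval_cases a₀ <;> cases x <;> cases y <;> cases z <;> simp at hω he ⊢ <;> try omega
    · obtain ⟨rfl, rfl⟩ : a₁ = l + 3 ∧ a₂ = 0 := by omega
      simp
    · obtain ⟨rfl, rfl⟩ : a₁ = l + 2 ∧ a₂ = 0 := by omega
      simp
    · obtain ⟨rfl, rfl⟩ : a₁ = l + 1 ∧ a₂ = 1 := by omega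
      simp
  · rintro (rfl | rfl | rfl) <;>
    exact ⟨_, _, _, _, _, _, rfl, by simp; try omega⟩

lemma setOf_good_one (n l : ℕ) {d : ℕ}
    (hd : (d : ℤ) = (2 * (n + 4) - 2) * (l + 7 : ℕ) + 2 - (1 : ℕ)) :
    {b : CEMon (n + 4) | ¬ CEBad (n + 4) b ∧ CElen (n + 4) b = l + 7 ∧ CEdeg (n + 4) b = d ∧
      CEwt (n + 4) b = 1} = {(topExp n 0 (l + 5) 0, topSet n true false false),
        (topExp n 1 (l + 3) 1, topSet n true false false),
        (topExp n 1 (l + 4) 0, topSet n false true false)} := by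
  rw [setOf_good_eq hd]
  ext b
  constructor
  · rintro ⟨a₀, a₁, a₂, x, y, z, rfl, ha, hk, hω, he⟩
    interval_cases a₀ <;> cases x <;> cases y <;> cases z <;> simp at hω he ⊢ <;> try omega
    · obtain ⟨rfl, rfl⟩ : a₁ = l + 5 ∧ a₂ = 0 := by omega
      simp
    · obtain ⟨rfl, rfl⟩ : a₁ = l + 4 ∧ a₂ = 0 := by omega
      simp
    · obtain ⟨rfl, rfl⟩ : a₁ = l + 3 ∧ a₂ = 1 := by omega
      simp
  · rintro (rfl | rfl | rfl) <;>
    exact ⟨_, _, _, _, _, _, rfl, by simp; try omega⟩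

lemma setOf_good_zero (n l : ℕ) {d : ℕ}
    (hd : (d : ℤ) = (2 * (n + 4) - 2) * (l + 7 : ℕ) + 2 - (0 : ℕ)) :
    {b : CEMon (n + 4) | ¬ CEBad (n + 4) b ∧ CElen (n + 4) b = l + 7 ∧ CEdeg (n + 4) b = d ∧
      CEwt (n + 4) b = 0} = {(topExp n 1 (l + 6) 0, topSet n false false false)} := by
  rw [setOf_good_eq hd]
  ext b
  constructor
  · rintro ⟨a₀, a₁, a₂, x, y, z, rfl, ha, hk, hω, he⟩
    cases x <;> cases y <;> cases z <;> simp at hω he ⊢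
    obtain ⟨rfl, rfl, rfl⟩ : a₀ = 1 ∧ a₁ = l + 6 ∧ a₂ = 0 := by omega
    rfl
  · rintro rfl
    exact ⟨_, _, _, _, _, _, rfl, by simp; try omega⟩

lemma CErd_single (m : ℕ) (b : CEMon m) :
    CErd m (Finsupp.single b 1) = ∑ j ∈ b.2, ∑ a : Fin (m + 1),
      if h : j.val ≤ a.val then
        (-1 : ℚ) ^ (b.2.filter (fun l => l < j)).card • CEproj m (Finsupp.single
          (b.1 + Pi.single a 1 + Pi.single (⟨m + j.val - a.val, by omega⟩ : Fin (m + 1)) 1,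
            b.2.erase j) 1)
      else 0 := by
  simp only [CErd, CEd, CEdMon, LinearMap.comp_apply, Finsupp.lift_apply, zero_smul,
    Finsupp.sum_single_index, one_smul, map_sum]
  refine sum_congr rfl fun j _ => sum_congr rfl fun a _ => ?_
  split_ifs
  · rw [← map_smul, Finsupp.smul_single_one]
  · exact map_zero _

lemma CEproj_single_of_bad {m : ℕ} {b : CEMon m} (h : CEBad m b) :
    CEproj m (Finsupp.single b 1) = 0 := by
  simp [CEproj, h]

lemma CEproj_single_of_not_bad {m : ℕ} {b : CEMon m} (h : ¬ CEBad m b) :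
    CEproj m (Finsupp.single b 1) = Finsupp.single b 1 := by
  simp [CEproj, h]

lemma erase_topSet₁ (n : ℕ) (x y z : Bool) :
    (topSet n x y z).erase ⟨n + 3, by omega⟩ = topSet n false y z := by
  ext j
  simp only [mem_erase, mem_topSet, ne_eq, Fin.ext_iff]
  grind

lemma erase_topSet₂ (n : ℕ) (x y z : Bool) :
    (topSet n x y z).erase ⟨n + 2, by omega⟩ = topSet n x false z := by
  ext j
  simp only [mem_erase, mem_topSet, ne_eq, Fin.ext_iff]
  grind

lemma erase_topSet₃ (n : ℕ) (x y z : Bool) :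
    (topSet n x y z).erase ⟨n + 1, by omega⟩ = topSet n x y false := by
  ext j
  simp only [mem_erase, mem_topSet, ne_eq, Fin.ext_iff]
  grind

lemma filter_lt_topSet₁ (n : ℕ) (x y z : Bool) :
    (topSet n x y z).filter (fun l => l < ⟨n + 3, by omega⟩) = topSet n false y z := by
  ext j
  simp only [mem_filter, mem_topSet, Fin.lt_def]
  grind

lemma filter_lt_topSet₂ (n : ℕ) (x y z : Bool) :
    (topSet n x y z).filter (fun l => l < ⟨n + 2, by omega⟩) = topSet n false false z := by
  ext j
  simp only [mem_filter, mem_topSet, Fin.lt_def]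
  grind

lemma filter_lt_topSet₃ (n : ℕ) (x y z : Bool) :
    (topSet n x y z).filter (fun l => l < ⟨n + 1, by omega⟩) = topSet n false false false := by
  ext j
  simp only [mem_filter, mem_topSet, Fin.lt_def]
  grind

lemma topExp_add_single₀ (n a b c : ℕ) :
    topExp n a b c + Pi.single ⟨n + 4, by omega⟩ 1 = topExp n (a + 1) b c := by
  ext i
  simp only [topExp, Pi.add_apply, Pi.single_apply, Fin.ext_iff]
  grind

lemma topExp_add_single₁ (n a b c : ℕ) :
    topExp n a b c + Pi.single ⟨n + 3, by omega⟩ 1 = topExp n a (b + 1) c := by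
  ext i
  simp only [topExp, Pi.add_apply, Pi.single_apply, Fin.ext_iff]
  grind

lemma topExp_add_single₂ (n a b c : ℕ) :
    topExp n a b c + Pi.single ⟨n + 2, by omega⟩ 1 = topExp n a b (c + 1) := by
  ext i
  simp only [topExp, Pi.add_apply, Pi.single_apply, Fin.ext_iff]
  grind

lemma sum_dite_of_lt {M : Type*} [AddCommMonoid M] {n j : ℕ} (hj : n < j)
    (f : ∀ a : Fin (n + 5), j ≤ a.val → M) :
    ∑ a : Fin (n + 5), (if h : j ≤ a.val then f a h else 0) =
      (if h : j ≤ n + 1 then f ⟨n + 1, by omega⟩ h else 0) +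
      (if h : j ≤ n + 2 then f ⟨n + 2, by omega⟩ h else 0) +
      (if h : j ≤ n + 3 then f ⟨n + 3, by omega⟩ h else 0) +
      (if h : j ≤ n + 4 then f ⟨n + 4, by omega⟩ h else 0) := by
  rw [Fin.sum_univ_split_last_four, Finset.sum_eq_zero, zero_add]
  intro i _
  rw [dif_neg]
  simp only
  omega

/-- The differential of a product of generators of top degree, before discarding the bad
monomials it contains. -/
lemma CErd_topMon (n a b c : ℕ) (x y z : Bool) :
    CErd (n + 4) (Finsupp.single (topExp n a b c, topSet n x y z) 1) =
      (if z then
        (2 : ℚ) • CEproj (n + 4) (Finsupp.single (topExp n (a + 1) b c +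
          Pi.single ⟨n + 1, by omega⟩ 1, topSet n x y false) 1) +
        (2 : ℚ) • CEproj (n + 4) (Finsupp.single (topExp n a (b + 1) (c + 1),
          topSet n x y false) 1)
      else 0) +
      (if y then (-1 : ℚ) ^ z.toNat • (
        (2 : ℚ) • CEproj (n + 4) (Finsupp.single (topExp n (a + 1) b (c + 1),
          topSet n x false z) 1) +
        CEproj (n + 4) (Finsupp.single (topExp n a (b + 2) c, topSet n x false z) 1))
      else 0) +
      (if x then (2 * (-1 : ℚ) ^ (y.toNat + z.toNat)) •
        CEproj (n + 4) (Finsupp.single (topExp n (a + 1) (b + 1) c, topSet n false y z) 1)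
      else 0) := by
  have hC₁ : n + 4 + (n + 1) - (n + 1) = n + 4 := by omega
  have hC₂ : n + 4 + (n + 1) - (n + 2) = n + 3 := by omega
  have hC₃ : n + 4 + (n + 1) - (n + 3) = n + 2 := by omega
  have hB₂ : n + 4 + (n + 2) - (n + 2) = n + 4 := by omega
  have hB₃ : n + 4 + (n + 2) - (n + 3) = n + 3 := by omega
  have hB₄ : n + 4 + (n + 2) - (n + 4) = n + 2 := by omega
  have hC₄ : n + 4 + (n + 1) - (n + 4) = n + 1 := by omega
  have hA₃ : n + 4 + (n + 3) - (n + 3) = n + 4 := by omega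
  have hA₄ : n + 4 + (n + 3) - (n + 4) = n + 3 := by omega
  have hcomm : topExp n a b c + Pi.single ⟨n + 1, by omega⟩ 1 + Pi.single ⟨n + 4, by omega⟩ 1 =
      topExp n (a + 1) b c + Pi.single ⟨n + 1, by omega⟩ 1 := by
    rw [add_right_comm, topExp_add_single₀]
  rw [CErd_single, sum_topSet, sum_dite_of_lt (by simp), sum_dite_of_lt (by simp),
    sum_dite_of_lt (by simp)]
  simp only [erase_topSet₁, erase_topSet₂, erase_topSet₃, filter_lt_topSet₁, filter_lt_topSet₂,
    filter_lt_topSet₃, card_topSet, hC₁, hC₂, hC₃, hC₄, hA₃, hA₄, hB₂, hB₃, hB₄, topExp_add_single₀,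
    topExp_add_single₁, topExp_add_single₂, hcomm]
  have d₁ : ¬ n + 2 ≤ n + 1 := by omega
  have d₂ : ¬ n + 3 ≤ n + 1 := by omega
  have d₃ : ¬ n + 3 ≤ n + 2 := by omega
  simp only [d₁, d₂, d₃, dite_false, add_le_add_iff_left, Nat.one_le_ofNat, le_refl, dite_true,
    Nat.reduceLeDiff, zero_add, Bool.toNat_false, pow_zero, one_smul]
  congr 1
  · congr 1
    · split_ifs
      · module
      · rfl
    · split_ifs
      · module
      · rfl
  · split_ifs
    · module
    · rfl

/-- The differential of a top-degree monomial divisible by `v_{2m}`. -/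
lemma CErd_topMon_one (n b c : ℕ) (x y z : Bool) :
    CErd (n + 4) (Finsupp.single (topExp n 1 b c, topSet n x y z) 1) =
      (if z then (2 : ℚ) • Finsupp.single (topExp n 1 (b + 1) (c + 1), topSet n x y false) 1
        else 0) +
      (if y then (-1 : ℚ) ^ z.toNat •
        Finsupp.single (topExp n 1 (b + 2) c, topSet n x false z) 1 else 0) := by
  have hs : CEBad (n + 4) (topExp n (1 + 1) b c + Pi.single ⟨n + 1, by omega⟩ 1,
      topSet n x y false) := by
    simp [CEBad, topExp]
  rw [CErd_topMon, CEproj_single_of_bad hs,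
    CEproj_single_of_bad (CEBad_topMon.2 (by omega) : CEBad _ (topExp n (1 + 1) b (c + 1), _)),
    CEproj_single_of_bad (CEBad_topMon.2 (by omega) : CEBad _ (topExp n (1 + 1) (b + 1) c, _)),
    CEproj_single_of_not_bad (by rw [CEBad_topMon]; omega),
    CEproj_single_of_not_bad (by rw [CEBad_topMon]; omega)]
  simp

/-- The differential of a top-degree monomial not divisible by `v_{2m}` nor by `w_{4m-7}`. -/
lemma CErd_topMon_zero (n b c : ℕ) (x y : Bool) :
    CErd (n + 4) (Finsupp.single (topExp n 0 b c, topSet n x y false) 1) =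
      (if y then (2 : ℚ) • Finsupp.single (topExp n 1 b (c + 1), topSet n x false false) 1 +
        Finsupp.single (topExp n 0 (b + 2) c, topSet n x false false) 1 else 0) +
      (if x then (2 * (-1 : ℚ) ^ y.toNat) •
        Finsupp.single (topExp n 1 (b + 1) c, topSet n false y false) 1 else 0) := by
  rw [CErd_topMon, CEproj_single_of_not_bad (b := (topExp n (0 + 1) b (c + 1), _))
      (by rw [CEBad_topMon]; omega),
    CEproj_single_of_not_bad (b := (topExp n 0 (b + 2) c, _)) (by rw [CEBad_topMon]; omega),
    CEproj_single_of_not_bad (b := (topExp n (0 + 1) (b + 1) c, _)) (by rw [CEBad_topMon]; omega)]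
  simp

open Classical in
lemma finrank_supported_finset {ι : Type*} (s : Finset ι) :
    Module.finrank ℚ (Finsupp.supported ℚ ℚ (s : Set ι)) = s.card := by
  rw [(Finsupp.supportedEquivFinsupp (s : Set ι)).finrank_eq, Module.finrank_finsupp_self]
  simp

lemma exists_of_mem_supported_singleton {ι : Type*} {a : ι} {f : ι →₀ ℚ}
    (hf : f ∈ Finsupp.supported ℚ ℚ {a}) : ∃ r : ℚ, f = r • Finsupp.single a 1 := by
  rw [Finsupp.supported_eq_span_single, Set.image_singleton, Submodule.mem_span_singleton] at hf
  obtain ⟨r, rfl⟩ := hf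
  exact ⟨r, rfl⟩

lemma exists_of_mem_supported_triple {ι : Type*} {a b c : ι} {f : ι →₀ ℚ}
    (hf : f ∈ Finsupp.supported ℚ ℚ {a, b, c}) : ∃ r s t : ℚ,
      f = r • Finsupp.single a 1 + s • Finsupp.single b 1 + t • Finsupp.single c 1 := by
  rw [Finsupp.supported_eq_span_single, Set.image_insert_eq, Set.image_pair,
    Submodule.mem_span_triple] at hf
  obtain ⟨r, s, t, rfl⟩ := hf
  exact ⟨r, s, t, rfl⟩

open Finsupp in
/-- An explicit exact sequence `0 → ℚ → ℚ³ → ℚ³ → ℚ → 0` inside a space of finitely supported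
functions. -/
lemma four_term_exact {ι : Type*} (D : (ι →₀ ℚ) →ₗ[ℚ] (ι →₀ ℚ)) {x y₁ y₂ y₃ z₁ z₂ z₃ t : ι}
    (hy₁₂ : y₁ ≠ y₂) (hy₁₃ : y₁ ≠ y₃) (hy₂₃ : y₂ ≠ y₃)
    (hz₁₂ : z₁ ≠ z₂) (hz₁₃ : z₁ ≠ z₃) (hz₂₃ : z₂ ≠ z₃)
    (hx : D (single x 1) = (2 : ℚ) • single y₂ 1 - single y₃ 1)
    (hy₁ : D (single y₁ 1) = (2 : ℚ) • single z₂ 1 + single z₁ 1 - (2 : ℚ) • single z₃ 1)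
    (hy₂ : D (single y₂ 1) = single z₂ 1)
    (hy₃ : D (single y₃ 1) = (2 : ℚ) • single z₂ 1)
    (hz₁ : D (single z₁ 1) = (2 : ℚ) • single t 1)
    (hz₂ : D (single z₂ 1) = 0)
    (hz₃ : D (single z₃ 1) = single t 1) :
    Module.finrank ℚ (supported ℚ ℚ {x}) = 1 ∧
    Module.finrank ℚ (supported ℚ ℚ {y₁, y₂, y₃}) = 3 ∧
    Module.finrank ℚ (supported ℚ ℚ {z₁, z₂, z₃}) = 3 ∧
    Module.finrank ℚ (supported ℚ ℚ {t}) = 1 ∧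
    (∀ f ∈ supported ℚ ℚ {x}, D f ∈ supported ℚ ℚ {y₁, y₂, y₃}) ∧
    (∀ f ∈ supported ℚ ℚ {y₁, y₂, y₃}, D f ∈ supported ℚ ℚ {z₁, z₂, z₃}) ∧
    (∀ f ∈ supported ℚ ℚ {z₁, z₂, z₃}, D f ∈ supported ℚ ℚ {t}) ∧
    (∀ f ∈ supported ℚ ℚ {x}, D f = 0 → f = 0) ∧
    Submodule.map D (supported ℚ ℚ {x}) =
      LinearMap.ker D ⊓ supported ℚ ℚ {y₁, y₂, y₃} ∧
    Submodule.map D (supported ℚ ℚ {y₁, y₂, y₃}) =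
      LinearMap.ker D ⊓ supported ℚ ℚ {z₁, z₂, z₃} ∧
    (∀ g ∈ supported ℚ ℚ {t}, ∃ f ∈ supported ℚ ℚ {z₁, z₂, z₃}, D f = g) := by
  classical
  have hmem (s : Set ι) (i : ι) (hi : i ∈ s) : single i (1 : ℚ) ∈ supported ℚ ℚ s :=
    single_mem_supported ℚ 1 hi
  have mx := hmem {x} x (by simp)
  have my₁ := hmem {y₁, y₂, y₃} y₁ (by simp)
  have my₂ := hmem {y₁, y₂, y₃} y₂ (by simp)
  have my₃ := hmem {y₁, y₂, y₃} y₃ (by simp)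
  have mz₁ := hmem {z₁, z₂, z₃} z₁ (by simp)
  have mz₂ := hmem {z₁, z₂, z₃} z₂ (by simp)
  have mz₃ := hmem {z₁, z₂, z₃} z₃ (by simp)
  have mt := hmem {t} t (by simp)
  have Dx (r : ℚ) : D (r • single x 1) = r • ((2 : ℚ) • single y₂ 1 - single y₃ 1) := by
    rw [map_smul, hx]
  have Dy (r s u : ℚ) : D (r • single y₁ 1 + s • single y₂ 1 + u • single y₃ 1) =
      r • single z₁ 1 + (2 * r + s + 2 * u) • single z₂ 1 + (-2 * r) • single z₃ 1 := by
    simp only [map_add, map_smul, hy₁, hy₂, hy₃]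
    module
  have Dz (r s u : ℚ) : D (r • single z₁ 1 + s • single z₂ 1 + u • single z₃ 1) =
      (2 * r + u) • single t 1 := by
    simp only [map_add, map_smul, hz₁, hz₂, hz₃]
    module
  have lift₁ (r : ℚ) : r • single x 1 ∈ supported ℚ ℚ {x} := Submodule.smul_mem _ _ mx
  have lift₂ (r s u : ℚ) : r • single y₁ 1 + s • single y₂ 1 + u • single y₃ 1 ∈
      supported ℚ ℚ {y₁, y₂, y₃} :=
    add_mem (add_mem (Submodule.smul_mem _ _ my₁) (Submodule.smul_mem _ _ my₂))
      (Submodule.smul_mem _ _ my₃)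
  have lift₃ (r s u : ℚ) : r • single z₁ 1 + s • single z₂ 1 + u • single z₃ 1 ∈
      supported ℚ ℚ {z₁, z₂, z₃} :=
    add_mem (add_mem (Submodule.smul_mem _ _ mz₁) (Submodule.smul_mem _ _ mz₂))
      (Submodule.smul_mem _ _ mz₃)
  have map₁ : ∀ f ∈ supported ℚ ℚ {x}, D f ∈ supported ℚ ℚ {y₁, y₂, y₃} := by
    intro f hf
    obtain ⟨r, rfl⟩ := exists_of_mem_supported_singleton hf
    rw [Dx]
    exact Submodule.smul_mem _ _ (sub_mem (Submodule.smul_mem _ _ my₂) my₃)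
  have map₂ : ∀ f ∈ supported ℚ ℚ {y₁, y₂, y₃}, D f ∈ supported ℚ ℚ {z₁, z₂, z₃} := by
    intro f hf
    obtain ⟨r, s, u, rfl⟩ := exists_of_mem_supported_triple hf
    rw [Dy]
    exact lift₃ _ _ _
  have map₃ : ∀ f ∈ supported ℚ ℚ {z₁, z₂, z₃}, D f ∈ supported ℚ ℚ {t} := by
    intro f hf
    obtain ⟨r, s, u, rfl⟩ := exists_of_mem_supported_triple hf
    rw [Dz]
    exact Submodule.smul_mem _ _ mt
  refine ⟨?_, ?_, ?_, ?_, map₁, map₂, map₃, ?_, le_antisymm ?_ ?_, le_antisymm ?_ ?_, ?_⟩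
  · have := finrank_supported_finset {x}
    rwa [card_singleton, coe_singleton] at this
  · have := finrank_supported_finset {y₁, y₂, y₃}
    rwa [card_eq_three.2 ⟨_, _, _, hy₁₂, hy₁₃, hy₂₃, rfl⟩, coe_insert, coe_pair] at this
  · have := finrank_supported_finset {z₁, z₂, z₃}
    rwa [card_eq_three.2 ⟨_, _, _, hz₁₂, hz₁₃, hz₂₃, rfl⟩, coe_insert, coe_pair] at this
  · have := finrank_supported_finset {t}
    rwa [card_singleton, coe_singleton] at this
  · intro f hf h
    obtain ⟨r, rfl⟩ := exists_of_mem_supported_singleton hf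
    rw [Dx] at h
    have h₃ := DFunLike.congr_fun h y₃
    simp [hy₂₃] at h₃
    simp [h₃]
  · rintro _ ⟨f, hf, rfl⟩
    refine ⟨?_, map₁ f hf⟩
    obtain ⟨r, rfl⟩ := exists_of_mem_supported_singleton hf
    rw [SetLike.mem_coe, LinearMap.mem_ker, Dx, map_smul, map_sub, map_smul, hy₂, hy₃, sub_self, smul_zero]
  · rintro g ⟨h, hg⟩
    obtain ⟨r, s, u, rfl⟩ := exists_of_mem_supported_triple hg
    rw [SetLike.mem_coe, LinearMap.mem_ker, Dy] at h
    have h₁ := DFunLike.congr_fun h z₁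
    have h₂ := DFunLike.congr_fun h z₂
    simp [hz₁₂, hz₁₂.symm, hz₁₃, hz₂₃] at h₁ h₂
    subst h₁
    obtain rfl : s = -2 * u := by linarith
    refine ⟨_, lift₁ (-u), ?_⟩
    rw [Dx]
    module
  · rintro _ ⟨f, hf, rfl⟩
    refine ⟨?_, map₂ f hf⟩
    obtain ⟨r, s, u, rfl⟩ := exists_of_mem_supported_triple hf
    rw [SetLike.mem_coe, LinearMap.mem_ker, Dy, Dz]
    module
  · rintro g ⟨h, hg⟩
    obtain ⟨r, s, u, rfl⟩ := exists_of_mem_supported_triple hg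
    rw [SetLike.mem_coe, LinearMap.mem_ker, Dz] at h
    have ht := DFunLike.congr_fun h t
    simp at ht
    obtain rfl : u = -2 * r := by linarith
    refine ⟨_, lift₂ r (s - 2 * r) 0, ?_⟩
    rw [Dy]
    module
  · intro g hg
    obtain ⟨r, rfl⟩ := exists_of_mem_supported_singleton hg
    refine ⟨_, lift₃ 0 0 r, ?_⟩
    rw [Dz]
    module

end TopDegree

/-- For `m ≥ 4` and `k > 8`, the pieces `ʳΩ_k^{(2m-2)k-1,3}`,
`ʳΩ_k^{(2m-2)k,2}`, `ʳΩ_k^{(2m-2)k+1,1}`, `ʳΩ_k^{(2m-2)k+2,0}` of the reduced complex have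
dimensions `1, 3, 3, 1`, the differential maps each piece to the next, and the resulting
four-term sequence (with zeros on both ends) is exact. -/
theorem reduced_four_term_exact_top (m k : ℕ) (hm : 4 ≤ m) (hk : 8 < k) :
    Module.finrank ℚ (CErOmega m k ((2 * m - 2) * k - 1) 3) = 1 ∧
    Module.finrank ℚ (CErOmega m k ((2 * m - 2) * k) 2) = 3 ∧
    Module.finrank ℚ (CErOmega m k ((2 * m - 2) * k + 1) 1) = 3 ∧
    Module.finrank ℚ (CErOmega m k ((2 * m - 2) * k + 2) 0) = 1 ∧
    (∀ x ∈ CErOmega m k ((2 * m - 2) * k - 1) 3,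
      CErd m x ∈ CErOmega m k ((2 * m - 2) * k) 2) ∧
    (∀ x ∈ CErOmega m k ((2 * m - 2) * k) 2,
      CErd m x ∈ CErOmega m k ((2 * m - 2) * k + 1) 1) ∧
    (∀ x ∈ CErOmega m k ((2 * m - 2) * k + 1) 1,
      CErd m x ∈ CErOmega m k ((2 * m - 2) * k + 2) 0) ∧
    (∀ x ∈ CErOmega m k ((2 * m - 2) * k - 1) 3, CErd m x = 0 → x = 0) ∧
    Submodule.map (CErd m) (CErOmega m k ((2 * m - 2) * k - 1) 3)
      = LinearMap.ker (CErd m) ⊓ CErOmega m k ((2 * m - 2) * k) 2 ∧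
    Submodule.map (CErd m) (CErOmega m k ((2 * m - 2) * k) 2)
      = LinearMap.ker (CErd m) ⊓ CErOmega m k ((2 * m - 2) * k + 1) 1 ∧
    (∀ z ∈ CErOmega m k ((2 * m - 2) * k + 2) 0,
      ∃ y ∈ CErOmega m k ((2 * m - 2) * k + 1) 1, CErd m y = z) := by
  obtain ⟨n, rfl⟩ : ∃ n, m = n + 4 := ⟨m - 4, by omega⟩
  obtain ⟨l, rfl⟩ : ∃ l, k = l + 7 := ⟨k - 7, by omega⟩
  obtain ⟨K, hK⟩ : ∃ K, (2 * (n + 4) - 2) * (l + 7) = K := ⟨_, rfl⟩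
  have hK' : (2 * ((n : ℤ) + 4) - 2) * (l + 7 : ℕ) = K := by
    rw [← hK]
    push_cast [show 2 ≤ 2 * (n + 4) by omega]
    ring
  have hpos : 1 ≤ K := by
    rw [← hK]
    exact Nat.mul_pos (by omega) (by omega)
  have h₃ : CErOmega (n + 4) (l + 7) ((2 * (n + 4) - 2) * (l + 7) - 1) 3 = Finsupp.supported ℚ ℚ
      {(topExp n 1 l 0, topSet n true true true)} :=
    congrArg _ (setOf_good_three n l (by rw [hK, hK']; omega))
  have h₂ : CErOmega (n + 4) (l + 7) ((2 * (n + 4) - 2) * (l + 7)) 2 = Finsupp.supported ℚ ℚ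
      {(topExp n 0 (l + 3) 0, topSet n true true false),
        (topExp n 1 (l + 1) 1, topSet n true true false),
        (topExp n 1 (l + 2) 0, topSet n true false true)} :=
    congrArg _ (setOf_good_two n l (by rw [hK, hK']; omega))
  have h₁ : CErOmega (n + 4) (l + 7) ((2 * (n + 4) - 2) * (l + 7) + 1) 1 = Finsupp.supported ℚ ℚ
      {(topExp n 0 (l + 5) 0, topSet n true false false),
        (topExp n 1 (l + 3) 1, topSet n true false false),
        (topExp n 1 (l + 4) 0, topSet n false true false)} :=
    congrArg _ (setOf_good_one n l (by rw [hK, hK']; omega))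
  have h₀ : CErOmega (n + 4) (l + 7) ((2 * (n + 4) - 2) * (l + 7) + 2) 0 = Finsupp.supported ℚ ℚ
      {(topExp n 1 (l + 6) 0, topSet n false false false)} :=
    congrArg _ (setOf_good_zero n l (by rw [hK, hK']; omega))
  rw [h₃, h₂, h₁, h₀]
  have ne_of_exp {i : Fin (n + 5)} {b b' : CEMon (n + 4)} (h : b.1 i ≠ b'.1 i) : b ≠ b' :=
    fun hb => h (by rw [hb])
  apply four_term_exact
  · exact ne_of_exp (i := ⟨n + 4, by omega⟩) (by simp [topExp])
  · exact ne_of_exp (i := ⟨n + 4, by omega⟩) (by simp [topExp])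
  · exact ne_of_exp (i := ⟨n + 2, by omega⟩) (by simp [topExp])
  · exact ne_of_exp (i := ⟨n + 4, by omega⟩) (by simp [topExp])
  · exact ne_of_exp (i := ⟨n + 4, by omega⟩) (by simp [topExp])
  · exact ne_of_exp (i := ⟨n + 2, by omega⟩) (by simp [topExp])
  · rw [CErd_topMon_one]
    simp [sub_eq_add_neg]
  · rw [CErd_topMon_zero]
    simp [sub_eq_add_neg]
  · rw [CErd_topMon_one]
    simp
  · rw [CErd_topMon_one]
    simp
  · rw [CErd_topMon_zero]
    simp
  · rw [CErd_topMon_one]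
    simp
  · rw [CErd_topMon_one]
    simp
end

section
/- For every m ≥ 4 and k > 8, the cohomology of the reduced complex ʳΩ_k^{*,*}(CP^m) vanishes in each of the cohomological degrees (2m-2)k - 2, (2m-2)k - 1, and (2m-2)k. -/
section CEOperators

variable {m : ℕ}

/-- Multiplication by the monomial in the even generators with exponents `u`. -/
noncomputable def CEmulV (u : Fin (m + 1) → ℕ) : CEAlg m →ₗ[ℚ] CEAlg m :=
  Finsupp.lmapDomain ℚ ℚ (fun b : CEMon m => (b.1 + u, b.2))

open Classical in
/-- Left multiplication by the odd generator `w_{2m-1+2j}`. -/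
noncomputable def CEmulW (j : Fin (m + 1)) : CEAlg m →ₗ[ℚ] CEAlg m :=
  Finsupp.lift (CEAlg m) ℚ (CEMon m) (fun b => if j ∈ b.2 then 0 else
    Finsupp.single (b.1, insert j b.2) ((-1 : ℚ) ^ (b.2.filter (fun l => l < j)).card))

/-- Multiplication by `∂ w_{2m-1+2j}`. -/
noncomputable def CEmulDW (j : Fin (m + 1)) : CEAlg m →ₗ[ℚ] CEAlg m :=
  ∑ a : Fin (m + 1), if h : j.val ≤ a.val then
    CEmulV (Pi.single a 1 + Pi.single (⟨m + j.val - a.val, by omega⟩ : Fin (m + 1)) 1) else 0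

lemma CEmulV_single (u : Fin (m + 1) → ℕ) (b : CEMon m) (c : ℚ) :
    CEmulV u (Finsupp.single b c) = Finsupp.single (b.1 + u, b.2) c := by
  simp [CEmulV, Finsupp.lmapDomain_apply, Finsupp.mapDomain_single]

lemma CEmulW_single_one (j : Fin (m + 1)) (b : CEMon m) :
    CEmulW j (Finsupp.single b 1) = if j ∈ b.2 then 0 else
      Finsupp.single (b.1, insert j b.2) ((-1 : ℚ) ^ (b.2.filter (fun l => l < j)).card) := by
  simp [CEmulW, -Finsupp.single_mul]

lemma CEmulW_single (j : Fin (m + 1)) (b : CEMon m) (c : ℚ) :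
    CEmulW j (Finsupp.single b c) = if j ∈ b.2 then 0 else
      Finsupp.single (b.1, insert j b.2)
        (c * (-1 : ℚ) ^ (b.2.filter (fun l => l < j)).card) := by
  simp [CEmulW, -Finsupp.single_mul]

lemma CEd_single_one (b : CEMon m) : CEd m (Finsupp.single b 1) = CEdMon m b := by
  simp [CEd]

open Classical in
lemma CEproj_single (b : CEMon m) (c : ℚ) :
    CEproj m (Finsupp.single b c) = if CEBad m b then 0 else Finsupp.single b c := by
  simp [CEproj]

lemma CEmulV_injective (u : Fin (m + 1) → ℕ) : Function.Injective (CEmulV u) := by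
  apply Finsupp.mapDomain_injective
  rintro ⟨e, S⟩ ⟨e', S'⟩ h
  simpa using h

lemma CEmulV_mulV (u u' : Fin (m + 1) → ℕ) (x : CEAlg m) :
    CEmulV u (CEmulV u' x) = CEmulV (u + u') x := by
  induction x using Finsupp.induction_linear with
  | zero => simp
  | add f g hf hg => simp [hf, hg]
  | single b c => simp [CEmulV_single, add_comm, add_left_comm]

lemma CEBad.add_left {b : CEMon m} (hb : CEBad m b) (u : Fin (m + 1) → ℕ) :
    CEBad m (b.1 + u, b.2) := by
  rcases hb with h | h
  · left; simp; omega
  · exact Or.inr h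

lemma CEproj_mulV_proj (u : Fin (m + 1) → ℕ) (x : CEAlg m) :
    CEproj m (CEmulV u (CEproj m x)) = CEproj m (CEmulV u x) := by
  induction x using Finsupp.induction_linear with
  | zero => simp
  | add f g hf hg => simp [hf, hg]
  | single b c =>
    by_cases hb : CEBad m b
    · simp [CEproj_single, CEmulV_single, hb, hb.add_left u]
    · simp [CEproj_single, hb]

lemma CEproj_mulV {u : Fin (m + 1) → ℕ} (hu : u (Fin.last m) = 0) (x : CEAlg m) :
    CEproj m (CEmulV u x) = CEmulV u (CEproj m x) := by
  induction x using Finsupp.induction_linear with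
  | zero => simp
  | add f g hf hg => simp [hf, hg]
  | single b c =>
    have h : CEBad m (b.1 + u, b.2) ↔ CEBad m b := by simp [CEBad, hu]
    by_cases hb : CEBad m b <;> simp [CEproj_single, CEmulV_single, h, hb]

lemma CEproj_mulV_eq_zero {u : Fin (m + 1) → ℕ} (hu : 2 ≤ u (Fin.last m)) (x : CEAlg m) :
    CEproj m (CEmulV u x) = 0 := by
  induction x using Finsupp.induction_linear with
  | zero => simp
  | add f g hf hg => simp [hf, hg]
  | single b c =>
    have h : CEBad m (b.1 + u, b.2) := Or.inl (by simp; omega)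
    simp [CEproj_single, CEmulV_single, h]

lemma CEproj_mulW {j : Fin (m + 1)} (hj : j ≠ Fin.last m) (x : CEAlg m) :
    CEproj m (CEmulW j x) = CEmulW j (CEproj m x) := by
  induction x using Finsupp.induction_linear with
  | zero => simp
  | add f g hf hg => simp [hf, hg]
  | single b c =>
    have h : CEBad m (b.1, insert j b.2) ↔ CEBad m b := by simp [CEBad, hj.symm]
    by_cases hb : CEBad m b <;> by_cases hjb : j ∈ b.2 <;>
      simp [CEproj_single, CEmulW_single, h, hb, hjb, -Finsupp.single_mul]

lemma CEd_mulV (u : Fin (m + 1) → ℕ) (x : CEAlg m) :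
    CEd m (CEmulV u x) = CEmulV u (CEd m x) := by
  suffices h : (CEd m).comp (CEmulV u) = (CEmulV u).comp (CEd m) from LinearMap.congr_fun h x
  refine Finsupp.lhom_ext' fun b => LinearMap.ext_ring ?_
  simp only [LinearMap.comp_apply, Finsupp.lsingle_apply, CEmulV_single, CEd_single_one, CEdMon,
    map_sum]
  refine Finset.sum_congr rfl fun j _ => Finset.sum_congr rfl fun a _ => ?_
  split_ifs
  · rw [CEmulV_single]
    congr 2
    simp only [add_left_comm, add_comm]
  · simp

lemma CErd_proj (x : CEAlg m) : CErd m (CEproj m x) = CErd m x := by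
  suffices h : (CErd m).comp (CEproj m) = CErd m from LinearMap.congr_fun h x
  refine Finsupp.lhom_ext' fun b => LinearMap.ext_ring ?_
  simp only [LinearMap.comp_apply, Finsupp.lsingle_apply, CEproj_single]
  split_ifs with hb
  · simp only [CErd, LinearMap.comp_apply, CEd_single_one, CEdMon, map_sum, map_zero]
    symm
    refine Finset.sum_eq_zero fun j _ => Finset.sum_eq_zero fun a _ => ?_
    split_ifs with ha
    · rw [CEproj_single, if_pos]
      rcases hb with hb | hb
      · left
        simp only [Pi.add_apply]
        omega
      · by_cases hj : j = Fin.last m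
        · left
          have ha' : a = Fin.last m := by
            subst hj
            exact Fin.ext (le_antisymm (Fin.le_last a) ha)
          subst hj ha'
          have : (⟨m + (Fin.last m).val - (Fin.last m).val, by simp⟩ : Fin (m + 1)) =
            Fin.last m := by ext; simp
          simp only [this, Pi.add_apply, Pi.single_eq_same]
          omega
        · exact Or.inr (Finset.mem_erase.2 ⟨Ne.symm hj, hb⟩)
    · simp
  · rfl

/-- The signs in `CEd` and `CEmulW` anticommute. -/
lemma CE_sign_anticomm {S : Finset (Fin (m + 1))} {i j : Fin (m + 1)} (hi : i ∈ S) (hj : j ∉ S) :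
    (-1 : ℚ) ^ (S.filter (· < j)).card * (-1) ^ ((insert j S).filter (· < i)).card =
      -((-1) ^ (S.filter (· < i)).card * (-1) ^ ((S.erase i).filter (· < j)).card) := by
  rw [Finset.filter_insert, Finset.filter_erase]
  have hij : i ≠ j := fun h => hj (h ▸ hi)
  rcases lt_or_gt_of_ne hij with h | h
  · have hmem : i ∈ S.filter (· < j) := Finset.mem_filter.2 ⟨hi, h⟩
    rw [if_neg h.not_gt, ← Finset.card_erase_add_one hmem]
    ring
  · rw [if_pos h, Finset.card_insert_of_notMem (by simp [hj]), Finset.erase_eq_of_notMem]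
    · ring
    · simp [h.le]

lemma CEd_mulW (j : Fin (m + 1)) (x : CEAlg m) :
    CEd m (CEmulW j x) = CEmulDW j x - CEmulW j (CEd m x) := by
  suffices h : (CEd m).comp (CEmulW j) = CEmulDW j - (CEmulW j).comp (CEd m) from
    LinearMap.congr_fun h x
  refine Finsupp.lhom_ext' fun b => LinearMap.ext_ring ?_
  obtain ⟨e, S⟩ := b
  simp only [LinearMap.comp_apply, Finsupp.lsingle_apply, LinearMap.sub_apply, CEd_single_one,
    CEmulW_single_one]
  have hsq : ∀ n : ℕ, (-1 : ℚ) ^ n * (-1) ^ n = 1 := fun n => by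
    rw [← mul_pow]; simp
  by_cases hj : j ∈ S
  · rw [if_pos hj, map_zero, eq_comm, sub_eq_zero]
    simp only [CEdMon, map_sum, CEmulDW, LinearMap.sum_apply]
    rw [Finset.sum_eq_single_of_mem j hj]
    · refine Finset.sum_congr rfl fun a _ => ?_
      split_ifs with ha
      · rw [CEmulV_single, CEmulW_single, if_neg (by simp)]
        simp only [Finset.insert_erase hj, Finset.filter_erase]
        rw [Finset.erase_eq_of_notMem (s := S.filter (· < j)) (by simp), hsq, add_assoc]
      · simp
    · intro i _ hij
      refine Finset.sum_eq_zero fun a _ => ?_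
      split_ifs with ha
      · rw [CEmulW_single, if_pos (by simp [hj, hij.symm])]
      · simp
  · rw [if_neg hj, ← mul_one ((-1 : ℚ) ^ _), ← smul_eq_mul, ← Finsupp.smul_single, map_smul,
      CEd_single_one]
    simp only [CEdMon, map_sum, CEmulDW, LinearMap.sum_apply]
    rw [Finset.sum_insert hj, smul_add, sub_eq_add_neg]
    congr 1
    · rw [Finset.smul_sum]
      refine Finset.sum_congr rfl fun a _ => ?_
      split_ifs with ha
      · rw [CEmulV_single, Finset.erase_insert hj, Finset.filter_insert, if_neg (lt_irrefl j),
          Finsupp.smul_single, smul_eq_mul, hsq, add_assoc]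
      · simp
    · rw [Finset.smul_sum, ← Finset.sum_neg_distrib]
      refine Finset.sum_congr rfl fun i hi => ?_
      rw [Finset.smul_sum, ← Finset.sum_neg_distrib]
      refine Finset.sum_congr rfl fun a _ => ?_
      have hij : i ≠ j := fun h => hj (h ▸ hi)
      split_ifs with ha
      · rw [CEmulW_single, if_neg (by simp [hj]), Finsupp.smul_single, smul_eq_mul,
          CE_sign_anticomm hi hj, Finset.erase_insert_of_ne hij.symm, Finsupp.single_neg]
      · simp

end CEOperators

section Vanishing

variable {m : ℕ}

/-- The index of `v_{2m-2c}` and of `w_{4m-1-2c}`. -/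
def CEtop (m c : ℕ) : Fin (m + 1) := ⟨m - c, by omega⟩

lemma CEtop_one_ne_last (hm : 2 ≤ m) : CEtop m 1 ≠ Fin.last m := by
  simp only [ne_eq, Fin.ext_iff, CEtop, Fin.val_last]
  omega

lemma CEtop_two_ne_last (hm : 2 ≤ m) : CEtop m 2 ≠ Fin.last m := by
  simp only [ne_eq, Fin.ext_iff, CEtop, Fin.val_last]
  omega

/-- Good monomials without `w_{4m-5}` of degree close to `(2m-2)k` are divisible by a high power of
`v_{2m-2}`. -/
lemma CE_exponent_bound {k i : ℕ} (hm : 2 ≤ m) (hk : 8 < k) (hi : (2 * m - 2) * k ≤ i + 2)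
    {b : CEMon m} (hb : ¬ CEBad m b) (hlen : CElen m b = k) (hdeg : CEdeg m b = i)
    (hS : CEtop m 2 ∉ b.2) :
    15 ≤ 3 * b.1 (CEtop m 1) + 7 * b.1 (Fin.last m) := by
  obtain ⟨e, S⟩ := b
  simp only [CEBad, not_or, CElen, CEdeg] at *
  have hV : ∑ i : Fin (m + 1), (3 - 2 * ((2 * m - 2 : ℤ) - 2 * i.val)) * (e i : ℤ) ≤
      3 * e (CEtop m 1) + 7 * e (Fin.last m) := by
    calc _ ≤ ∑ i : Fin (m + 1), ((if i = CEtop m 1 then 3 * (e i : ℤ) else 0) +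
          (if i = Fin.last m then 7 * (e i : ℤ) else 0)) := by
          refine Finset.sum_le_sum fun i _ => ?_
          have he : (0 : ℤ) ≤ e i := by positivity
          have hi := i.isLt
          have h1 : i = CEtop m 1 ↔ i.val = m - 1 := by simp [Fin.ext_iff, CEtop]
          have h2 : i = Fin.last m ↔ i.val = m := by simp [Fin.ext_iff]
          simp only [h1, h2]
          split_ifs with h3 h4 h4
          · omega
          · have : (i.val : ℤ) = m - 1 := by omega
            rw [this]; nlinarith
          · have : (i.val : ℤ) = m := by omega
            rw [this]; nlinarith
          · have : (i.val : ℤ) ≤ m - 2 := by omega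
            nlinarith
      _ = _ := by simp [Finset.sum_add_distrib]
  have hW : ∑ j ∈ S, (6 - 2 * ((4 * m - 4 : ℤ) - (2 * m + 2 * j.val - 1))) ≤ 8 := by
    calc _ ≤ ∑ j ∈ S, (if j = CEtop m 1 then (8 : ℤ) else 0) := by
          refine Finset.sum_le_sum fun j hj => ?_
          have hlt := j.isLt
          have h1 : j = CEtop m 1 ↔ j.val = m - 1 := by simp [Fin.ext_iff, CEtop]
          have h2 : j.val ≠ m := fun h => hb.2 (by
            rwa [show Fin.last m = j from Fin.ext (by simp [h])])
          have h3 : j.val ≠ m - 2 := fun h => hS (by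
            rwa [show CEtop m 2 = j from Fin.ext (by simp [h, CEtop])])
          simp only [h1]
          split_ifs <;> omega
      _ ≤ 8 := by
          rw [Finset.sum_ite_eq']
          split_ifs <;> simp
  have hdegZ : (i : ℤ) = ∑ i : Fin (m + 1), 2 * (i.val : ℤ) * e i +
      ∑ j ∈ S, (2 * m + 2 * (j.val : ℤ) - 1) := by
    rw [← hdeg]
    push_cast
    congr 1
    refine Finset.sum_congr rfl fun j _ => ?_
    omega
  have hlenZ : (k : ℤ) = ∑ i : Fin (m + 1), (e i : ℤ) + 2 * S.card := by
    rw [← hlen]; push_cast; rfl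
  have hiZ : (2 * m - 2 : ℤ) * k ≤ i + 2 := by
    zify [show 2 ≤ 2 * m by omega] at hi
    exact hi
  have hsumV : ∑ i : Fin (m + 1), (3 - 2 * ((2 * m - 2 : ℤ) - 2 * i.val)) * (e i : ℤ) =
      (3 - 2 * (2 * m - 2)) * ∑ i : Fin (m + 1), (e i : ℤ) +
        2 * ∑ i : Fin (m + 1), 2 * (i.val : ℤ) * e i := by
    rw [Finset.mul_sum, Finset.mul_sum, ← Finset.sum_add_distrib]
    exact Finset.sum_congr rfl fun _ _ => by ring
  have hsumW : ∑ j ∈ S, (6 - 2 * ((4 * m - 4 : ℤ) - (2 * m + 2 * j.val - 1))) =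
      S.card * (6 - 2 * (4 * m - 4)) + 2 * ∑ j ∈ S, (2 * m + 2 * (j.val : ℤ) - 1) := by
    rw [Finset.mul_sum, ← nsmul_eq_mul, ← Finset.sum_const, ← Finset.sum_add_distrib]
    exact Finset.sum_congr rfl fun _ _ => by ring
  have key : (3 : ℤ) * k - 2 * ((2 * m - 2) * k - i) ≤
      3 * e (CEtop m 1) + 7 * e (Fin.last m) + 8 := by
    calc _ = (3 - 2 * (2 * m - 2 : ℤ)) * k + 2 * i := by ring
      _ = _ + _ := by rw [hlenZ, hdegZ]; ring
      _ ≤ _ := add_le_add (hsumV ▸ hV) (hsumW ▸ hW)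
  omega

lemma single_mem_map_mulV {k i p d : ℕ} {u : Fin (m + 1) → ℕ}
    (hp : ∑ l, u l = p) (hd : ∑ l : Fin (m + 1), 2 * l.val * u l = d) {b : CEMon m}
    (hub : u ≤ b.1) (hb : ¬ CEBad m b)
    (hlen : CElen m b = k + p) (hdeg : CEdeg m b = i + d) (c : ℚ) :
    Finsupp.single b c ∈ (CErOmegaDeg m k i).map (CEmulV u) := by
  obtain ⟨e, S⟩ := b
  obtain ⟨e, rfl⟩ : ∃ e', e = e' + u := ⟨e - u, (tsub_add_cancel_of_le hub).symm⟩
  refine ⟨Finsupp.single (e, S) c, Finsupp.single_mem_supported ℚ c ⟨?_, ?_, ?_⟩,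
    CEmulV_single _ _ _⟩
  · exact fun h => hb (h.add_left u)
  · simp only [CElen, Pi.add_apply, Finset.sum_add_distrib, hp] at hlen ⊢
    omega
  · simp only [CEdeg, Pi.add_apply, mul_add, Finset.sum_add_distrib, hd] at hdeg ⊢
    omega

lemma sum_weight_single (c : Fin (m + 1)) (n : ℕ) :
    ∑ l : Fin (m + 1), 2 * l.val * (Pi.single c n : Fin (m + 1) → ℕ) l = 2 * c.val * n := by
  simp [Pi.single_apply]

/-- The numerator of the contracting homotopy: multiplication by
`w_{4m-5} (v_{2m-2}² - 2 v_{2m} v_{2m-4})`. -/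
noncomputable def CEhomotopy (m : ℕ) : CEAlg m →ₗ[ℚ] CEAlg m :=
  (CEmulW (CEtop m 2)).comp (CEmulV (Pi.single (CEtop m 1) 2) -
    (2 : ℚ) • CEmulV (Pi.single (Fin.last m) 1 + Pi.single (CEtop m 2) 1))

lemma CEmulDW_top_two (hm : 2 ≤ m) (x : CEAlg m) :
    CEmulDW (CEtop m 2) x = CEmulV (Pi.single (CEtop m 1) 2) x +
      (2 : ℚ) • CEmulV (Pi.single (Fin.last m) 1 + Pi.single (CEtop m 2) 1) x := by
  have hpos : ∀ a c : Fin (m + 1), a.val + c.val = m + (m - 2) →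
      (if h : (CEtop m 2).val ≤ a.val then
        CEmulV (Pi.single a 1 + Pi.single
          (⟨m + (CEtop m 2).val - a.val, by omega⟩ : Fin (m + 1)) 1) else 0) =
        CEmulV (Pi.single a 1 + Pi.single c 1) := by
    intro a c h
    have hc := c.isLt
    have ha : (CEtop m 2).val ≤ a.val := by simp only [CEtop]; omega
    have hac : (⟨m + (CEtop m 2).val - a.val, by omega⟩ : Fin (m + 1)) = c :=
      Fin.ext (by simp only [CEtop]; omega)
    rw [dif_pos ha, hac]
  rw [CEmulDW, ← Finset.sum_subset (Finset.subset_univ {CEtop m 2, CEtop m 1, Fin.last m}),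
    Finset.sum_insert, Finset.sum_insert, Finset.sum_singleton,
    hpos (CEtop m 2) (Fin.last m) (by simp only [CEtop, Fin.val_last]; omega),
    hpos (CEtop m 1) (CEtop m 1) (by simp only [CEtop]; omega),
    hpos (Fin.last m) (CEtop m 2) (by simp only [CEtop, Fin.val_last]),
    ← Pi.single_add, add_comm (Pi.single (CEtop m 2) 1)]
  · simp only [LinearMap.add_apply, two_smul, Nat.reduceAdd]
    abel
  · simp [Fin.ext_iff, CEtop]
    omega
  · simp [Fin.ext_iff, CEtop]
    omega
  · intro a _ ha
    simp only [Finset.mem_insert, Finset.mem_singleton, Fin.ext_iff, CEtop, Fin.val_last] at ha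
    exact dif_neg (by simp only [CEtop]; omega)

lemma CErd_homotopy (hm : 2 ≤ m) {z : CEAlg m} (hz : CErd m z = 0) :
    CErd m (CEhomotopy m z) = CEmulV (Pi.single (CEtop m 1) 4) (CEproj m z) := by
  have h1 := CEtop_one_ne_last hm
  have h2 := CEtop_two_ne_last hm
  have hV : ∀ u : Fin (m + 1) → ℕ, CErd m (CEmulV u z) = 0 := fun u => by
    have hz' : CEproj m (CEd m z) = 0 := hz
    rw [CErd, LinearMap.comp_apply, CEd_mulV, ← CEproj_mulV_proj, hz']
    simp
  have hz2 : CEproj m (CEd m ((CEmulV (Pi.single (CEtop m 1) 2) - (2 : ℚ) •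
      CEmulV (Pi.single (Fin.last m) 1 + Pi.single (CEtop m 2) 1) : CEAlg m →ₗ[ℚ] CEAlg m) z)) =
      0 := by
    have hd : ∀ x, CEproj m (CEd m x) = CErd m x := fun _ => rfl
    simp [hd, hV]
  rw [CErd, LinearMap.comp_apply, CEhomotopy, LinearMap.comp_apply, CEd_mulW, map_sub,
    CEproj_mulW h2, hz2, CEmulDW_top_two hm,
    ← CEproj_mulV (u := Pi.single (CEtop m 1) 4) (by simp [h1.symm])]
  have hcomm := add_comm (Pi.single (CEtop m 1) 2 : Fin (m + 1) → ℕ)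
    (Pi.single (Fin.last m) 1 + Pi.single (CEtop m 2) 1)
  have hkill : CEproj m (CEmulV (Pi.single (Fin.last m) 1 + Pi.single (CEtop m 2) 1 +
      (Pi.single (Fin.last m) 1 + Pi.single (CEtop m 2) 1)) z) = 0 :=
    CEproj_mulV_eq_zero (by simp [h2.symm]) z
  simp only [LinearMap.sub_apply, LinearMap.smul_apply, map_sub, map_add, map_smul, CEmulV_mulV,
    hkill, ← Pi.single_add, hcomm, map_zero]
  module

lemma CEproj_of_mem {k i : ℕ} {z : CEAlg m} (hz : z ∈ CErOmegaDeg m k i) : CEproj m z = z := by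
  refine Submodule.span_induction (p := fun z _ => CEproj m z = z) ?_ (by simp)
    (fun x y _ _ hx hy => by rw [map_add, hx, hy]) (fun c x _ hx => by rw [map_smul, hx])
    (by rwa [CErOmegaDeg, Finsupp.supported_eq_span_single] at hz)
  rintro _ ⟨b, hb, rfl⟩
  rw [CEproj_single, if_neg hb.1]

lemma CEproj_homotopy_mem {k i : ℕ} (hm : 2 ≤ m) (hk : 8 < k) (hi : (2 * m - 2) * k ≤ i + 2)
    {z : CEAlg m} (hz : z ∈ CErOmegaDeg m k i) :
    CEproj m (CEhomotopy m z) ∈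
      (CErOmegaDeg m k (i - 1)).map (CEmulV (Pi.single (CEtop m 1) 4)) := by
  have h1 := CEtop_one_ne_last hm
  have h2 := CEtop_two_ne_last hm
  have hi1 : 1 ≤ i := by
    have : 2 * 9 ≤ (2 * m - 2) * k := Nat.mul_le_mul (by omega) hk
    omega
  suffices hle : CErOmegaDeg m k i ≤ ((CErOmegaDeg m k (i - 1)).map
      (CEmulV (Pi.single (CEtop m 1) 4))).comap ((CEproj m).comp (CEhomotopy m)) from hle hz
  rw [CErOmegaDeg, Finsupp.supported_eq_span_single, Submodule.span_le]
  rintro _ ⟨⟨e, S⟩, ⟨hb, hlen, hdeg⟩, rfl⟩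
  simp only [SetLike.mem_coe, Submodule.mem_comap, LinearMap.comp_apply, CEhomotopy,
    LinearMap.sub_apply, LinearMap.smul_apply, map_sub, map_smul, CEmulV_single, CEmulW_single]
  by_cases hS : CEtop m 2 ∈ S
  · simp [hS]
  have hbound := CE_exponent_bound hm hk hi hb hlen hdeg hS
  have hbad : ∀ u : Fin (m + 1) → ℕ, u (Fin.last m) ≤ 1 → ¬ CEBad m (u, insert (CEtop m 2) S) := by
    intro u hu
    simp only [CEBad, not_or, Finset.mem_insert] at hb ⊢
    exact ⟨by omega, h2.symm, hb.2⟩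
  have he : e (Fin.last m) ≤ 1 := by
    simp only [CEBad, not_or] at hb
    omega
  have hmem : ∀ (u : Fin (m + 1) → ℕ) (c : ℚ), (e + u) (Fin.last m) ≤ 1 →
      4 ≤ (e + u) (CEtop m 1) → ∑ l, u l = 2 →
      ∑ l : Fin (m + 1), 2 * l.val * u l = 4 * m - 4 →
      Finsupp.single (e + u, insert (CEtop m 2) S) c ∈
        (CErOmegaDeg m k (i - 1)).map (CEmulV (Pi.single (CEtop m 1) 4)) := by
    intro u c hu1 hu4 hu hu'
    refine single_mem_map_mulV (p := 4) (d := 8 * (m - 1)) (by simp) ?_ ?_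
      (hbad _ hu1) ?_ ?_ c
    · rw [sum_weight_single]
      simp only [CEtop]
      omega
    · intro l
      by_cases hl : l = CEtop m 1
      · subst hl
        simpa using hu4
      · simp [hl]
    · simp only [CElen, Pi.add_apply, Finset.sum_add_distrib, hu,
        Finset.card_insert_of_notMem hS] at hlen ⊢
      omega
    · simp only [CEdeg, Pi.add_apply, mul_add, Finset.sum_add_distrib, hu',
        Finset.sum_insert hS] at hdeg ⊢
      simp only [CEtop]
      omega
  rw [if_neg hS, if_neg hS]
  refine Submodule.sub_mem _ ?_ (Submodule.smul_mem _ _ ?_)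
  · rw [CEproj_single, if_neg (hbad _ (by simp [h1.symm, he]))]
    refine hmem _ _ (by simp [h1.symm, he]) ?_ (by simp) ?_
    · simp only [Pi.add_apply, Pi.single_eq_same] at hbound ⊢
      omega
    · rw [sum_weight_single]
      simp only [CEtop]
      omega
  · rw [CEproj_single]
    split_ifs with hbd
    · exact Submodule.zero_mem _
    have h0 : e (Fin.last m) = 0 := by
      simp only [CEBad, not_or, Pi.add_apply, Pi.single_eq_same, Pi.single_eq_of_ne h2.symm] at hbd
      omega
    refine hmem _ _ (by simp [h2.symm, h0]) ?_ (by simp [Finset.sum_add_distrib]) ?_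
    · simp only [Pi.add_apply] at hbound ⊢
      omega
    · simp only [Pi.add_apply, mul_add, Finset.sum_add_distrib, sum_weight_single]
      simp only [CEtop, Fin.val_last]
      omega

/-- The reduced complex is exact in degrees at least `(2m-2)k - 2`. -/
lemma CErCohomology_subsingleton {k i : ℕ} (hm : 2 ≤ m) (hk : 8 < k)
    (hi : (2 * m - 2) * k ≤ i + 2) : Subsingleton (CErCohomology m k i) := by
  rw [Submodule.Quotient.subsingleton_iff, eq_top_iff]
  rintro ⟨z, hz, hdz⟩ -
  obtain ⟨y, hy, hyz⟩ := CEproj_homotopy_mem hm hk hi hz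
  refine ⟨y, hy, CEmulV_injective (Pi.single (CEtop m 1) 4) ?_⟩
  have h1 := CEtop_one_ne_last hm
  have h := CErd_homotopy hm (LinearMap.mem_ker.1 hdz)
  rw [CEproj_of_mem hz, ← CErd_proj, ← hyz, CErd, LinearMap.comp_apply, CEd_mulV,
    CEproj_mulV (by simp [h1.symm])] at h
  exact h

end Vanishing

/-- For every `m ≥ 4` and `k > 8`, the cohomology of the reduced complex
`ʳΩ_k^{*,*}(ℂP^m)` vanishes in each of the cohomological degrees `(2m-2)k - 2`, `(2m-2)k - 1`
and `(2m-2)k`. -/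
theorem reduced_cohomology_vanishes (m k : ℕ) (hm : 4 ≤ m) (hk : 8 < k) :
    Subsingleton (CErCohomology m k ((2 * m - 2) * k - 2)) ∧
    Subsingleton (CErCohomology m k ((2 * m - 2) * k - 1)) ∧
    Subsingleton (CErCohomology m k ((2 * m - 2) * k)) := by
  refine ⟨?_, ?_, ?_⟩ <;> exact CErCohomology_subsingleton (by omega) hk (by omega)
end
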